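/- Consider the planar nonlinear system ẋ₁ = μx₁, ẋ₂ = λ(x₂ − x₁²) with real parameters μ, λ satisfying λ ≠ 2μ, and set b = λ/(λ − 2μ). The coordinate change φ(x₁, x₂) = (x₁, x₂ − b x₁²) is a bijection of ℝ² with inverse φ⁻¹(y₁, y₂) = (y₁, y₂ + b y₁²), and it globally linearizes the dynamics: if x : ℝ → ℝ² is differentiable and satisfies x₁'(t) = μ x₁(t), x₂'(t) = λ(x₂(t) − x₁(t)²) for all t, then y(t) = φ(x(t)) satisfies the linear system y₁'(t) = μ y₁(t), y₂'(t) = λ y₂(t) for all t; conversely, if y solves the linear system then x(t) = φ⁻¹(y(t)) solves the nonlinear system. -/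

import Mathlib

/-- The coordinate change `φ(x₁,x₂) = (x₁, x₂ − b x₁²)` is a bijection of `ℝ²`
with inverse `φ⁻¹(y₁,y₂) = (y₁, y₂ + b y₁²)` and globally linearizes the
system `ẋ₁ = μx₁`, `ẋ₂ = λ(x₂ − x₁²)`, where `b = λ/(λ − 2μ)`. -/
theorem global_linearization_discrete_spectrum
    (μ lam : ℝ) (hne : lam ≠ 2 * μ) (b : ℝ) (hb : b = lam / (lam - 2 * μ))
    (φ φinv : ℝ × ℝ → ℝ × ℝ)
    (hφ : φ = fun p => (p.1, p.2 - b * p.1 ^ 2))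
    (hφinv : φinv = fun p => (p.1, p.2 + b * p.1 ^ 2)) :
    Function.Bijective φ ∧
      Function.LeftInverse φinv φ ∧ Function.RightInverse φinv φ ∧
      (∀ x₁ x₂ : ℝ → ℝ,
        (∀ t : ℝ, HasDerivAt x₁ (μ * x₁ t) t) →
        (∀ t : ℝ, HasDerivAt x₂ (lam * (x₂ t - (x₁ t) ^ 2)) t) →
        (∀ t : ℝ, HasDerivAt (fun s => (φ (x₁ s, x₂ s)).1)
            (μ * (φ (x₁ t, x₂ t)).1) t) ∧
        (∀ t : ℝ, HasDerivAt (fun s => (φ (x₁ s, x₂ s)).2)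
            (lam * (φ (x₁ t, x₂ t)).2) t)) ∧
      (∀ y₁ y₂ : ℝ → ℝ,
        (∀ t : ℝ, HasDerivAt y₁ (μ * y₁ t) t) →
        (∀ t : ℝ, HasDerivAt y₂ (lam * y₂ t) t) →
        (∀ t : ℝ, HasDerivAt (fun s => (φinv (y₁ s, y₂ s)).1)
            (μ * (φinv (y₁ t, y₂ t)).1) t) ∧
        (∀ t : ℝ, HasDerivAt (fun s => (φinv (y₁ s, y₂ s)).2)
            (lam * ((φinv (y₁ t, y₂ t)).2 - ((φinv (y₁ t, y₂ t)).1) ^ 2)) t)) := by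
  have hb' : b * (lam - 2 * μ) = lam := by
    rw [hb]
    exact div_mul_cancel₀ _ (sub_ne_zero.mpr hne)
  have hl : Function.LeftInverse φinv φ := by
    intro p
    simp [hφ, hφinv]
  have hr : Function.RightInverse φinv φ := by
    intro p
    simp [hφ, hφinv]
  refine ⟨⟨hl.injective, hr.surjective⟩, hl, hr, ?_, ?_⟩
  · intro x₁ x₂ h1 h2
    subst hφ
    refine ⟨h1, fun t => ?_⟩
    refine ((h2 t).sub (((h1 t).pow 2).const_mul b)).congr_deriv ?_
    push_cast
    linear_combination (x₁ t) ^ 2 * hb'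
  · intro y₁ y₂ h1 h2
    subst hφinv
    refine ⟨h1, fun t => ?_⟩
    refine ((h2 t).add (((h1 t).pow 2).const_mul b)).congr_deriv ?_
    push_cast
    linear_combination (-(y₁ t) ^ 2) * hb'
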